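/- arXiv:1709.05841 — 2 statements merged into one kernel-verified Lean document; each statement's English description precedes it below -/
import Mathlib

section
/- Let A = KQ/I be a finite-dimensional algebra over an algebraically closed field K, where Q is a finite quiver and I is an admissible ideal of KQ. If A is geometrically irreducible, then every primitive cycle in Q is a loop. -/
open scoped BigOperators

noncomputable section
/-! ## Quivers and paths -/

/-- A finite quiver: finite sets of vertices and arrows together with source and
target maps. -/
structure FinQuiver : Type 1 where
  V : Type
  A : Type
  [fintypeV : Fintype V]
  [fintypeA : Fintype A]
  [decEqV : DecidableEq V]
  [decEqA : DecidableEq A]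
  src : A → V
  tgt : A → V

attribute [instance] FinQuiver.fintypeV FinQuiver.fintypeA FinQuiver.decEqV FinQuiver.decEqA

/-- A path of positive length in a quiver: a list of composable arrows `[a₁, …, aₘ]`
satisfying `s (aᵢ) = t (aᵢ₊₁)`. -/
structure QPath (Q : FinQuiver) : Type where
  arrows : List Q.A
  ne : arrows ≠ []
  chain : arrows.Chain' fun a b => Q.src a = Q.tgt b

namespace QPath

variable {Q : FinQuiver}

/-- The length of a path. -/
def length (p : QPath Q) : ℕ := p.arrows.length

/-- The target `t (a₁)` of a path `(a₁, …, aₘ)`. -/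
def tgt (p : QPath Q) : Q.V := Q.tgt (p.arrows.head p.ne)

/-- The source `s (aₘ)` of a path `(a₁, …, aₘ)`. -/
def src (p : QPath Q) : Q.V := Q.src (p.arrows.getLast p.ne)

/-- A path is a cycle if its source equals its target. -/
def IsCycle (p : QPath Q) : Prop := p.src = p.tgt

/-- A cycle `(a₁, …, aₘ)` is primitive if the vertices `s (a₁), …, s (aₘ)` are pairwise
different. -/
def IsPrimitive (p : QPath Q) : Prop := (p.arrows.map Q.src).Nodup

end QPath

/-! ## The path algebra, relations, admissible ideals and representation varieties -/

/-- The defining relations presenting the path algebra `KQ` as a quotient of the free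
algebra on the vertices and arrows of `Q`: the vertices become a complete set of
orthogonal idempotents summing to `1`, and `e_{t(a)} * a = a = a * e_{s(a)}` for every
arrow `a`. -/
inductive PathRel (K : Type) [Field K] (Q : FinQuiver) :
    FreeAlgebra K (Q.V ⊕ Q.A) → FreeAlgebra K (Q.V ⊕ Q.A) → Prop
  | idem (i : Q.V) : PathRel K Q
      (FreeAlgebra.ι K (Sum.inl i) * FreeAlgebra.ι K (Sum.inl i)) (FreeAlgebra.ι K (Sum.inl i))
  | orth (i j : Q.V) (h : i ≠ j) : PathRel K Q
      (FreeAlgebra.ι K (Sum.inl i) * FreeAlgebra.ι K (Sum.inl j)) 0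
  | sum_one : PathRel K Q (∑ i : Q.V, FreeAlgebra.ι K (Sum.inl i)) 1
  | tgt_mul (a : Q.A) : PathRel K Q
      (FreeAlgebra.ι K (Sum.inl (Q.tgt a)) * FreeAlgebra.ι K (Sum.inr a))
      (FreeAlgebra.ι K (Sum.inr a))
  | mul_src (a : Q.A) : PathRel K Q
      (FreeAlgebra.ι K (Sum.inr a) * FreeAlgebra.ι K (Sum.inl (Q.src a)))
      (FreeAlgebra.ι K (Sum.inr a))

/-- The path algebra `KQ`. -/
abbrev PathAlgebra (K : Type) [Field K] (Q : FinQuiver) : Type := RingQuot (PathRel K Q)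

variable (K : Type) [Field K] (Q : FinQuiver)

/-- The idempotent `eᵢ ∈ KQ` corresponding to a vertex `i` (the path of length zero
at `i`). -/
def vertexElem (i : Q.V) : PathAlgebra K Q :=
  RingQuot.mkAlgHom K (PathRel K Q) (FreeAlgebra.ι K (Sum.inl i))

/-- The element of `KQ` corresponding to an arrow `a`. -/
def arrowElem (a : Q.A) : PathAlgebra K Q :=
  RingQuot.mkAlgHom K (PathRel K Q) (FreeAlgebra.ι K (Sum.inr a))

/-- The element of `KQ` corresponding to a path `(a₁, …, aₘ)`, namely `a₁ ⋯ aₘ`. -/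
def pathElem (p : QPath Q) : PathAlgebra K Q := (p.arrows.map (arrowElem K Q)).prod

/-- The element `∑ₚ c p • p` of `KQ` determined by a finitely supported family of
coefficients on paths. -/
def relElem (c : QPath Q →₀ K) : PathAlgebra K Q := c.sum fun p l => l • pathElem K Q p

/-- `c` is the datum of a relation with common target `i` and common source `j`: all
paths in its support have length at least two, target `i` and source `j`.  (The paths in
the support are pairwise different and have nonzero coefficients by definition of a
finitely supported function.) -/
def IsRelationData (c : QPath Q →₀ K) (i j : Q.V) : Prop :=
  ∀ p ∈ c.support, 2 ≤ p.length ∧ p.tgt = i ∧ p.src = j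

/-- An element of `KQ` is a relation if it is a `K`-linear combination `∑ λₚ • p` of
pairwise different paths of length at least two having a common source and a common
target, with all `λₚ ≠ 0`. -/
def IsRelation (x : PathAlgebra K Q) : Prop :=
  ∃ (c : QPath Q →₀ K) (i j : Q.V), IsRelationData K Q c i j ∧ x = relElem K Q c

/-- The two-sided ideal generated by a set `S`, as a set: the additive subgroup generated
by all elements `a * s * b` with `s ∈ S`. -/
def twoSidedSpan (R : Type) [Ring R] (S : Set R) : Set R :=
  (AddSubgroup.closure {x | ∃ a b : R, ∃ s ∈ S, x = a * s * b} : AddSubgroup R)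

/-- `φ : KQ →ₐ[K] A` presents `A` as `KQ/I` with `I = ker φ` an admissible ideal:
`φ` is surjective, its kernel is generated (as a two-sided ideal) by a set of relations,
and there is some `m ≥ 2` such that all paths of length at least `m` lie in the kernel. -/
def IsAdmissiblePresentation {A : Type} [Ring A] [Algebra K A]
    (φ : PathAlgebra K Q →ₐ[K] A) : Prop :=
  Function.Surjective φ ∧
  (∃ S : Set (PathAlgebra K Q), (∀ x ∈ S, IsRelation K Q x) ∧
    twoSidedSpan (PathAlgebra K Q) S = {x | φ x = 0}) ∧
  ∃ m : ℕ, 2 ≤ m ∧ ∀ p : QPath Q, m ≤ p.length → φ (pathElem K Q p) = 0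

/-- The index type for the rows/columns of the matrices in a `d`-dimensional
representation: the basis vectors of `⊕ᵢ K^{dᵢ}`. -/
abbrev RepIx (d : Q.V → ℕ) : Type := (i : Q.V) × Fin (d i)

/-- The ambient affine space of `d`-dimensional representations.  An arrow `a` gets a
matrix; membership in `RepSet` forces the matrix of `a` to be concentrated in the block
with rows indexed by the block `t(a)` and columns indexed by the block `s(a)`, i.e. to be
(the block extension of) a `d (t a) × d (s a)`-matrix. -/
abbrev RepSpace (d : Q.V → ℕ) : Type := Q.A → Matrix (RepIx Q d) (RepIx Q d) K

/-- The Zariski topology on affine space `K^ι`: generated by the complements of zero sets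
of polynomials in the coordinates. -/
def zariskiTopology (ι R : Type) [CommSemiring R] : TopologicalSpace (ι → R) :=
  TopologicalSpace.generateFrom
    {U | ∃ f : MvPolynomial ι R, U = {x | MvPolynomial.eval x f ≠ 0}}

/-- The Zariski topology on the ambient space of `d`-dimensional representations. -/
def repTopology (d : Q.V → ℕ) : TopologicalSpace (RepSpace K Q d) :=
  TopologicalSpace.induced (fun M (x : Q.A × RepIx Q d × RepIx Q d) => M x.1 x.2.1 x.2.2)
    (zariskiTopology (Q.A × RepIx Q d × RepIx Q d) K)

/-- The condition that the matrix of each arrow `a` is concentrated in the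
`(t a, s a)`-block, i.e. really is a `d (t a) × d (s a)`-matrix. -/
def BlockCompatible (d : Q.V → ℕ) (M : RepSpace K Q d) : Prop :=
  ∀ (a : Q.A) (u v : RepIx Q d), M a u v ≠ 0 → u.1 = Q.tgt a ∧ v.1 = Q.src a

/-- The evaluation `M(p) = M(a₁) ⋯ M(aₘ)` of a representation at a path. -/
def pathProd (d : Q.V → ℕ) (M : RepSpace K Q d) (p : QPath Q) :
    Matrix (RepIx Q d) (RepIx Q d) K := (p.arrows.map M).prod

/-- The evaluation `M(ρ) = ∑ λₚ M(p)` of a representation at a linear combination of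
paths. -/
def relEval (d : Q.V → ℕ) (M : RepSpace K Q d) (c : QPath Q →₀ K) :
    Matrix (RepIx Q d) (RepIx Q d) K := c.sum fun p l => l • pathProd K Q d M p

/-- The affine variety `rep(A, d)` of `d`-dimensional representations of `A = KQ/I`,
where `I = ker φ`: tuples of matrices (of the correct block sizes) with `M(ρ) = 0` for
every relation `ρ ∈ I`. -/
def RepSet {A : Type} [Ring A] [Algebra K A] (φ : PathAlgebra K Q →ₐ[K] A) (d : Q.V → ℕ) :
    Set (RepSpace K Q d) :=
  {M | BlockCompatible K Q d M ∧
    ∀ (c : QPath Q →₀ K) (i j : Q.V), IsRelationData K Q c i j →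
      φ (relElem K Q c) = 0 → relEval K Q d M c = 0}

/-- `A = KQ/I` (presented by `φ`, with `I = ker φ`) is geometrically irreducible if
`rep(A, d)` is an irreducible topological space for every dimension vector `d`. -/
def IsGeomIrreducible {A : Type} [Ring A] [Algebra K A] (φ : PathAlgebra K Q →ₐ[K] A) :
    Prop :=
  ∀ d : Q.V → ℕ, @IsIrreducible _ (repTopology K Q d) (RepSet K Q φ d)

namespace QPath

variable {Q : FinQuiver}

/-- An arrow of a primitive cycle of length different from one is not a loop. -/
lemma IsPrimitive.src_ne_tgt {p : QPath Q} (hp : p.IsPrimitive) (hc : p.IsCycle)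
    (hl : p.length ≠ 1) {a : Q.A} (ha : a ∈ p.arrows) : Q.src a ≠ Q.tgt a := by
  obtain ⟨l, hne, hchain⟩ := p
  simp only [IsPrimitive, IsCycle, QPath.src, QPath.tgt, length] at hp hc hl ha
  intro h
  obtain ⟨l₁, l₂, rfl⟩ := List.append_of_mem ha
  rcases List.eq_nil_or_concat l₁ with rfl | ⟨l₃, b, rfl⟩
  · rcases List.eq_nil_or_concat l₂ with rfl | ⟨l₄, c, rfl⟩
    · simp at hl
    · simp_all [List.getLast_cons, List.nodup_append]
  · have hb : Q.src b = Q.tgt a := by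
      rw [List.Chain', List.concat_append, List.isChain_append_cons_cons] at hchain
      exact hchain.2.1
    simp_all [List.nodup_append]

/-- The path running `n + 1` times through a cycle. -/
def iterate (p : QPath Q) (hc : p.IsCycle) (n : ℕ) : QPath Q where
  arrows := (List.replicate (n + 1) p.arrows).flatten
  ne := by simp [p.ne]
  chain := by
    rw [List.Chain', List.isChain_flatten (by simp [p.ne.symm])]
    refine ⟨fun l hl => (List.eq_of_mem_replicate hl) ▸ p.chain,
      List.isChain_replicate_of_rel _ fun x hx y hy => ?_⟩
    rw [List.getLast?_eq_getLast_of_ne_nil p.ne, Option.mem_some_iff] at hx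
    rw [List.head?_eq_some_head p.ne, Option.mem_some_iff] at hy
    subst hx hy
    exact hc

lemma lt_length_iterate (p : QPath Q) (hc : p.IsCycle) (n : ℕ) :
    n < (p.iterate hc n).length := by
  have := List.length_pos_of_ne_nil p.ne
  simp only [length, iterate, List.length_flatten, List.map_replicate, List.sum_replicate,
    smul_eq_mul]
  nlinarith

lemma mem_of_mem_iterate {p : QPath Q} {hc : p.IsCycle} {n : ℕ} {a : Q.A}
    (ha : a ∈ (p.iterate hc n).arrows) : a ∈ p.arrows := by
  obtain ⟨l, hl, ha⟩ := List.mem_flatten.1 ha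
  exact List.eq_of_mem_replicate hl ▸ ha

end QPath

/-- The index of the basis vector at the vertex `i` for the dimension vector `(1, …, 1)`. -/
def thinIx (i : Q.V) : RepIx Q fun _ => 1 := ⟨i, 0⟩

lemma eq_thinIx (u : RepIx Q fun _ => 1) : u = thinIx Q u.1 := by
  obtain ⟨i, j⟩ := u
  rw [Subsingleton.elim j 0]
  rfl

/-- The scalar by which an arrow acts in a representation of dimension vector `(1, …, 1)`. -/
def thinScalar (M : RepSpace K Q fun _ => 1) (a : Q.A) : K :=
  M a (thinIx Q (Q.tgt a)) (thinIx Q (Q.src a))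

lemma BlockCompatible.thin_list_prod {M : RepSpace K Q fun _ => 1}
    (hM : BlockCompatible K Q _ M) (l : List Q.A) (hl : l ≠ [])
    (hc : l.IsChain fun a b => Q.src a = Q.tgt b) :
    (l.map M).prod (thinIx Q (Q.tgt (l.head hl))) (thinIx Q (Q.src (l.getLast hl))) =
      (l.map (thinScalar K Q M)).prod := by
  induction l with
  | nil => exact absurd rfl hl
  | cons a l ih =>
    cases l with
    | nil => simp [thinScalar]
    | cons b l =>
      rw [List.isChain_cons_cons] at hc
      have ih := ih (by simp) hc.2
      rw [List.head_cons, ← hc.1] at ih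
      rw [List.map_cons, List.prod_cons, Matrix.mul_apply,
        Finset.sum_eq_single (thinIx Q (Q.src a)), List.getLast_cons (by simp), ih]
      · rfl
      · intro w _ hw
        by_contra h
        refine hw ?_
        rw [eq_thinIx Q w, (hM a _ w (left_ne_zero_of_mul h)).2]
      · simp

/-- The representation of dimension vector `(1, …, 1)` in which `a` acts by `1` and all other
arrows act by `0`. -/
def arrowRep (a : Q.A) : RepSpace K Q fun _ => 1 :=
  Pi.single a (Matrix.single (thinIx Q (Q.tgt a)) (thinIx Q (Q.src a)) 1)

lemma thinScalar_arrowRep (a : Q.A) : thinScalar K Q (arrowRep K Q a) a = 1 := by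
  simp [thinScalar, arrowRep]

lemma arrowRep_mul {a : Q.A} (ha : Q.src a ≠ Q.tgt a) (b c : Q.A) :
    arrowRep K Q a b * arrowRep K Q a c = 0 := by
  have h : thinIx Q (Q.src a) ≠ thinIx Q (Q.tgt a) := fun h => ha (congrArg Sigma.fst h)
  by_cases hb : b = a
  · by_cases hc : c = a
    · subst hb hc
      simp [arrowRep, Matrix.single_mul_single_of_ne _ _ _ _ h]
    · simp [arrowRep, Pi.single_eq_of_ne hc]
  · simp [arrowRep, Pi.single_eq_of_ne hb]

lemma arrowRep_mem_repSet {A : Type} [Ring A] [Algebra K A] (φ : PathAlgebra K Q →ₐ[K] A)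
    {a : Q.A} (ha : Q.src a ≠ Q.tgt a) : arrowRep K Q a ∈ RepSet K Q φ fun _ => 1 := by
  refine ⟨fun b u v h => ?_, fun c i j hc _ => Finset.sum_eq_zero fun p hp => ?_⟩
  · by_cases hb : b = a
    · subst hb
      rw [arrowRep, Pi.single_eq_same, Matrix.single_apply] at h
      obtain ⟨⟨rfl, rfl⟩, -⟩ := ite_ne_right_iff.1 h
      exact ⟨rfl, rfl⟩
    · simp [arrowRep, Pi.single_eq_of_ne hb] at h
  · have h2 := (hc p hp).1
    obtain ⟨l, hne, hchain⟩ := p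
    match l, hne, hchain, h2 with
    | b :: b' :: l, _, _, _ =>
      simp [pathProd, ← mul_assoc, arrowRep_mul K Q ha]

lemma isOpen_thinScalar_ne_zero (a : Q.A) :
    @IsOpen _ (repTopology K Q fun _ => 1) {M | thinScalar K Q M a ≠ 0} := by
  refine (@isOpen_induced_iff _ _ (zariskiTopology _ K) _ _).2 ⟨_,
    TopologicalSpace.isOpen_generateFrom_of_mem ⟨MvPolynomial.X (a, thinIx Q (Q.tgt a), thinIx Q (Q.src a)), rfl⟩,
    ?_⟩
  ext M
  simp [thinScalar]

/-- In a representation of dimension vector `(1, …, 1)` every cycle contains an arrow acting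
by `0`. -/
lemma exists_thinScalar_eq_zero {A : Type} [Ring A] [Algebra K A] {φ : PathAlgebra K Q →ₐ[K] A}
    (hadm : IsAdmissiblePresentation K Q φ) {M : RepSpace K Q fun _ => 1}
    (hM : M ∈ RepSet K Q φ fun _ => 1) (p : QPath Q) (hc : p.IsCycle) :
    ∃ a ∈ p.arrows, thinScalar K Q M a = 0 := by
  obtain ⟨-, -, m, hm, hpaths⟩ := hadm
  have hlen := p.lt_length_iterate hc m
  set q := p.iterate hc m
  have hzero : pathProd K Q _ M q = 0 := by
    have h := hM.2 (Finsupp.single q 1) q.tgt q.src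
      (fun r hr => by
        rw [Finset.mem_singleton.1 (Finsupp.support_single_subset hr)]
        exact ⟨by omega, rfl, rfl⟩)
      (by simpa [relElem] using hpaths q hlen.le)
    simpa [relEval] using h
  have hprod := hM.1.thin_list_prod K Q q.arrows q.ne q.chain
  rw [← pathProd, hzero, Matrix.zero_apply] at hprod
  obtain ⟨a, ha, ha0⟩ := List.mem_map.1 (List.prod_eq_zero_iff.1 hprod.symm)
  exact ⟨a, QPath.mem_of_mem_iterate ha, ha0⟩

/-- Let `A = KQ/I` be a finite-dimensional algebra over an algebraically
closed field `K`, where `Q` is a finite quiver and `I` is an admissible ideal of `KQ`.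
If `A` is geometrically irreducible, then every primitive cycle in `Q` is a loop. -/
theorem primitive_cycle_is_loop_of_geomIrreducible [IsAlgClosed K]
    (A : Type) [Ring A] [Algebra K A] [Module.Finite K A]
    (φ : PathAlgebra K Q →ₐ[K] A) (hadm : IsAdmissiblePresentation K Q φ)
    (hirr : IsGeomIrreducible K Q φ) :
    ∀ p : QPath Q, p.IsCycle → p.IsPrimitive → p.length = 1 := by
  intro p hc hp
  by_contra hl
  classical
  let _ := repTopology K Q fun _ => 1
  obtain ⟨M, hM, hM'⟩ := isIrreducible_iff_sInter.1 (hirr fun _ => 1)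
    (p.arrows.toFinset.image fun a => {M | thinScalar K Q M a ≠ 0})
    (by
      intro U hU
      obtain ⟨a, -, rfl⟩ := Finset.mem_image.1 hU
      exact isOpen_thinScalar_ne_zero K Q a)
    (by
      intro U hU
      obtain ⟨a, ha, rfl⟩ := Finset.mem_image.1 hU
      refine ⟨arrowRep K Q a,
        arrowRep_mem_repSet K Q φ (hp.src_ne_tgt hc hl (List.mem_toFinset.1 ha)), ?_⟩
      simp [thinScalar_arrowRep])
  obtain ⟨a, ha, ha0⟩ := exists_thinScalar_eq_zero K Q hadm hM p hc
  exact hM' _ (Finset.mem_coe.2 (Finset.mem_image_of_mem _ (List.mem_toFinset.2 ha))) ha0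
end
end

section
/- Let A = KQ/I be a finite-dimensional algebra over an algebraically closed field K, where Q is a finite quiver and I is an admissible ideal of KQ. If A is geometrically irreducible, then for each vertex i of Q there is at most one loop ε with s(ε) = i. -/
open scoped BigOperators

noncomputable section
variable (K : Type) [Field K] (Q : FinQuiver)

/-! ## Cyclic vectors, cocyclic forms and Frobenius forms -/

section Bicyclic

variable {K} {B V : Type} [Ring B] [Algebra K B] [AddCommGroup V] [Module K V]

/-- A vector `v` generates the representation `ρ`. -/
def IsCyclicVector (ρ : B →ₐ[K] Module.End K V) (v : V) : Prop :=
  ∀ x, ∃ b, ρ b v = x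

/-- A linear form `f` cogenerates the representation `ρ`: no nonzero subrepresentation is
contained in its kernel. -/
def IsCocyclicForm (ρ : B →ₐ[K] Module.End K V) (f : Module.Dual K V) : Prop :=
  ∀ x, (∀ b, f (ρ b x) = 0) → x = 0

variable (K B) in
/-- Whenever `B` has a cyclic and a cocyclic representation of the same finite dimension,
it has one of that dimension which is both cyclic and cocyclic. -/
def HasBicyclicReps : Prop :=
  ∀ (V W : Type) [AddCommGroup V] [Module K V] [FiniteDimensional K V]
    [AddCommGroup W] [Module K W] [FiniteDimensional K W]
    (ρ : B →ₐ[K] Module.End K V) (σ : B →ₐ[K] Module.End K W) (v : V) (f : Module.Dual K W),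
    Module.finrank K V = Module.finrank K W → IsCyclicVector ρ v → IsCocyclicForm σ f →
    ∃ (ι : Type) (_ : Fintype ι) (τ : B →ₐ[K] Module.End K (ι → K)) (u : ι → K)
      (g : Module.Dual K (ι → K)),
      Fintype.card ι = Module.finrank K V ∧ IsCyclicVector τ u ∧ IsCocyclicForm τ g

/-- A linear form on `B` whose kernel contains no nonzero left ideal. -/
def IsFrobeniusForm (f : Module.Dual K B) : Prop :=
  ∀ y, (∀ c, f (c * y) = 0) → y = 0

variable (K B) in
/-- The left `B`-module structure on the dual of `B`. -/
def dualRegularRep : B →ₐ[K] Module.End K (Module.Dual K B) :=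
  AlgHom.ofLinearMap
    { toFun := fun b =>
        { toFun := fun h => h ∘ₗ LinearMap.mulRight K b
          map_add' := fun _ _ => rfl
          map_smul' := fun _ _ => rfl }
      map_add' := fun b c => by ext h x; simp [mul_add]
      map_smul' := fun r b => by ext h x; simp }
    (by ext h x; simp)
    (fun b c => by ext h x; simp [mul_assoc])

@[simp]
theorem dualRegularRep_apply (b : B) (h : Module.Dual K B) (x : B) :
    dualRegularRep K B b h x = h (x * b) := rfl

theorem IsFrobeniusForm.ext {f : Module.Dual K B} (hf : IsFrobeniusForm f) {x y : B}
    (h : ∀ c, f (c * x) = f (c * y)) : x = y :=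
  sub_eq_zero.1 <| hf _ fun c => by rw [mul_sub, map_sub, h, sub_self]

variable [FiniteDimensional K B]

theorem HasBicyclicReps.exists_isFrobeniusForm (hB : HasBicyclicReps K B) :
    ∃ f : Module.Dual K B, IsFrobeniusForm f := by
  obtain ⟨ι, _, τ, u, g, hn, hu, hg⟩ := hB B (Module.Dual K B) (Algebra.lmul K B)
    (dualRegularRep K B) 1 (Module.Dual.eval K B 1) Subspace.dual_finrank_eq.symm
    (fun x => ⟨x, by simp⟩)
    (fun h hh => by
      ext b
      simpa using hh b)
  let θ : B →ₗ[K] (ι → K) := (LinearMap.applyₗ u) ∘ₗ τ.toLinearMap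
  have hθs : Function.Surjective θ := hu
  have hθi : Function.Injective θ :=
    (LinearMap.injective_iff_surjective_of_finrank_eq_finrank (by simp [hn])).2 hθs
  refine ⟨g ∘ₗ θ, fun y hy => ?_⟩
  have : θ y = 0 := hg _ fun b => by simpa [θ] using hy b
  exact hθi (by simpa using this)

/-- A Frobenius form represents every linear form. -/
theorem IsFrobeniusForm.exists_forall_apply_mul_eq {f : Module.Dual K B}
    (hf : IsFrobeniusForm f) (h : Module.Dual K B) : ∃ w, ∀ c, f (c * w) = h c := by
  let Φ : B →ₗ[K] Module.Dual K B :=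
    (LinearMap.applyₗ f) ∘ₗ (dualRegularRep K B).toLinearMap
  have hΦi : Function.Injective Φ := by
    rw [← LinearMap.ker_eq_bot, LinearMap.ker_eq_bot']
    intro y hy
    exact hf y fun c => by simpa [Φ] using LinearMap.congr_fun hy c
  have hΦs : Function.Surjective Φ :=
    (LinearMap.injective_iff_surjective_of_finrank_eq_finrank
      Subspace.dual_finrank_eq.symm).1 hΦi
  obtain ⟨w, hw⟩ := hΦs h
  exact ⟨w, fun c => by simpa [Φ] using LinearMap.congr_fun hw c⟩

/-- For an augmented Frobenius algebra with the property of `HasBicyclicReps` there is a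
principal left ideal of codimension one. -/
theorem HasBicyclicReps.exists_finrank_range_mulRight (hB : HasBicyclicReps K B)
    (ε : B →ₐ[K] K) :
    ∃ x : B, Module.finrank K (LinearMap.range (LinearMap.mulRight K x)) + 1
      = Module.finrank K B := by
  obtain ⟨f, hf⟩ := hB.exists_isFrobeniusForm
  obtain ⟨w, hw⟩ := hf.exists_forall_apply_mul_eq ε.toLinearMap
  have hw0 : w ≠ 0 := by
    rintro rfl
    simpa using (hw 1).symm
  have hmul : ∀ y, y * w = ε y • w := fun y => hf.ext fun c => by
    rw [← mul_assoc, hw, mul_smul_comm, map_smul, hw]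
    simp [mul_comm]
  let L : Submodule B B := Submodule.span B {w}
  have hL : L.restrictScalars K = Submodule.span K {w} := by
    ext y
    simp only [L, Submodule.restrictScalars_mem, Submodule.mem_span_singleton, smul_eq_mul]
    constructor
    · rintro ⟨a, rfl⟩
      exact ⟨ε a, (hmul a).symm⟩
    · rintro ⟨r, rfl⟩
      exact ⟨algebraMap K B r, (Algebra.smul_def _ _).symm⟩
  have hLrank : Module.finrank K (B ⧸ L) + 1 = Module.finrank K B := by
    have h1 := Submodule.finrank_quotient_add_finrank (L.restrictScalars K)
    rw [hL, finrank_span_singleton hw0, ← hL] at h1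
    exact h1
  let R : Submodule B B := RingHom.ker ε
  have hRrank : Module.finrank K R + 1 = Module.finrank K B := by
    have h1 := LinearMap.finrank_range_add_finrank_ker ε.toLinearMap
    have h2 : LinearMap.range ε.toLinearMap = ⊤ :=
      LinearMap.range_eq_top.2 fun r => ⟨algebraMap K B r, by simp⟩
    rw [h2, finrank_top, Module.finrank_self, add_comm] at h1
    exact h1
  obtain ⟨ι, _, τ, u, g, hn, hu, hg⟩ := hB (B ⧸ L) R (Algebra.lsmul K K (B ⧸ L))
    (Algebra.lsmul K K R) (L.mkQ 1) (f ∘ₗ R.subtype.restrictScalars K) (by omega)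
    (fun x => by
      obtain ⟨b, rfl⟩ := L.mkQ_surjective x
      exact ⟨b, by rw [Algebra.lsmul_coe]; beta_reduce; rw [← map_smul, smul_eq_mul, mul_one]⟩)
    (fun x hx => Subtype.ext <| hf _ fun b => by simpa using hx b)
  choose j hj using fun x : ι → K =>
    hf.exists_forall_apply_mul_eq (g ∘ₗ (LinearMap.applyₗ x) ∘ₗ τ.toLinearMap)
  simp only [LinearMap.comp_apply, LinearMap.applyₗ_apply_apply, AlgHom.toLinearMap_apply] at hj
  let jl : (ι → K) →ₗ[K] B :=
    { toFun := j
      map_add' := fun x y => hf.ext fun c => by simp [mul_add, hj]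
      map_smul' := fun r x => hf.ext fun c => by simp [hj] }
  have hjl : Function.Injective jl := by
    rw [← LinearMap.ker_eq_bot, LinearMap.ker_eq_bot']
    intro x hx
    refine hg x fun b => ?_
    rw [← hj, show j x = 0 from hx, mul_zero, map_zero]
  refine ⟨j u, ?_⟩
  have hrange : LinearMap.range (LinearMap.mulRight K (j u)) = LinearMap.range jl := by
    have hmap : ∀ b, j (τ b u) = b * j u := fun b => hf.ext fun c => by
      rw [hj, ← mul_assoc, hj, map_mul]; rfl
    ext y
    constructor
    · rintro ⟨b, rfl⟩
      exact ⟨τ b u, hmap b⟩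
    · rintro ⟨x, rfl⟩
      obtain ⟨b, rfl⟩ := hu x
      exact ⟨b, (hmap b).symm⟩
  rw [hrange, LinearMap.finrank_range_of_inj hjl, Module.finrank_fintype_fun_eq_card, hn, hLrank]

/-- An augmented algebra with the property of `HasBicyclicReps` that is generated by nilpotent
elements does not surject onto the algebra `K[X, Y] / (X, Y)²`. -/
theorem HasBicyclicReps.not_inr_basis (hB : HasBicyclicReps K B) {S : Set B}
    (hS : Algebra.adjoin K S = ⊤) (hnil : ∀ s ∈ S, IsNilpotent s)
    (χ : B →ₐ[K] TrivSqZeroExt K (K × K)) {a b : B} (ha : a ∈ S) (hb : b ∈ S)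
    (hχa : χ a = TrivSqZeroExt.inr (1, 0)) (hχb : χ b = TrivSqZeroExt.inr (0, 1)) : False := by
  let ε : B →ₐ[K] K := (TrivSqZeroExt.fstHom K K (K × K)).comp χ
  obtain ⟨x, hx⟩ := hB.exists_finrank_range_mulRight ε
  set J := LinearMap.range (LinearMap.mulRight K x) with hJ
  have hJmul : ∀ c, ∀ y ∈ J, c * y ∈ J := by
    rintro c _ ⟨d, rfl⟩
    exact ⟨c * d, by simp [mul_assoc]⟩
  have hone : (1 : B) ∉ J := by
    intro h
    have : J = ⊤ := eq_top_iff.2 fun y _ => by simpa using hJmul y 1 h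
    rw [this, finrank_top] at hx
    omega
  have hquot : Module.finrank K (B ⧸ J) = 1 := by
    have := J.finrank_quotient_add_finrank
    omega
  have hdec : ∀ y, ∃ r : K, y - algebraMap K B r ∈ J := by
    intro y
    have h1 : J.mkQ 1 ≠ 0 := by simpa using hone
    obtain ⟨r, hr⟩ := (finrank_eq_one_iff_of_nonzero' _ h1).1 hquot (J.mkQ y)
    refine ⟨r, ?_⟩
    rw [← Submodule.Quotient.mk_eq_zero, ← Submodule.mkQ_apply, map_sub, ← hr,
      Algebra.algebraMap_eq_smul_one, map_smul, sub_self]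
  have hSJ : ∀ s ∈ S, s ∈ J := by
    intro s hs
    obtain ⟨r, hr⟩ := hdec s
    have hpow : ∀ k, s ^ k - algebraMap K B (r ^ k) ∈ J := by
      intro k
      induction k with
      | zero => simp
      | succ k ih =>
        have : s ^ (k + 1) - algebraMap K B (r ^ (k + 1))
            = s * (s ^ k - algebraMap K B (r ^ k))
              + algebraMap K B (r ^ k) * (s - algebraMap K B r) := by
          rw [mul_sub, mul_sub, Algebra.commutes (r ^ k) s, pow_succ', pow_succ, map_mul]
          abel
        rw [this]
        exact J.add_mem (hJmul _ _ ih) (hJmul _ _ hr)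
    obtain ⟨m, hm⟩ := hnil s hs
    have h1 := hpow m
    rw [hm, zero_sub, Submodule.neg_mem_iff, Algebra.algebraMap_eq_smul_one] at h1
    have hrm : r ^ m = 0 := by
      by_contra hne
      exact hone ((Submodule.smul_mem_iff _ hne).1 h1)
    rw [eq_zero_of_pow_eq_zero hrm, map_zero, sub_zero] at hr
    exact hr
  have hεS : ∀ s ∈ S, ε s = 0 := fun s hs => ((hnil s hs).map ε).eq_zero
  have hε : ∀ y, y - algebraMap K B (ε y) ∈ J := by
    intro y
    have hy : y ∈ Algebra.adjoin K S := hS ▸ Algebra.mem_top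
    induction hy using Algebra.adjoin_induction with
    | mem s hs => simpa [hεS s hs] using hSJ s hs
    | algebraMap r => simp
    | add y z _ _ hy hz =>
      have := J.add_mem hy hz
      rwa [sub_add_sub_comm, ← map_add, ← map_add] at this
    | mul y z _ _ hy hz =>
      have : y * z - algebraMap K B (ε (y * z))
          = y * (z - algebraMap K B (ε z)) + algebraMap K B (ε z) * (y - algebraMap K B (ε y)) := by
        rw [mul_sub, mul_sub, Algebra.commutes (ε z) y, map_mul, mul_comm (ε y), map_mul]
        abel
      rw [this]
      exact J.add_mem (hJmul _ _ hz) (hJmul _ _ hy)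
  have hxε : ε x = 0 := by
    have hxJ : x ∈ J := ⟨1, by simp⟩
    have h1 := (Submodule.sub_mem_iff_right J hxJ).1 (hε x)
    rw [Algebra.algebraMap_eq_smul_one] at h1
    by_contra hne
    exact hone ((Submodule.smul_mem_iff _ hne).1 h1)
  obtain ⟨c, rfl⟩ := hSJ a ha
  obtain ⟨d, rfl⟩ := hSJ b hb
  have hxfst : (χ x).fst = 0 := hxε
  have e1 := congrArg TrivSqZeroExt.snd hχa
  have e2 := congrArg TrivSqZeroExt.snd hχb
  simp [hxfst, Prod.ext_iff] at e1 e2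
  obtain ⟨h11, h12⟩ := e1
  obtain ⟨h21, h22⟩ := e2
  rcases h12 with h | h
  · simp [h] at h11
  · simp [h] at h22

end Bicyclic

/-! ## The local algebra at a vertex -/

section LocalAlgebra

variable {K} in
theorem exists_algHom_apply_of_surjective {R A T : Type} [Ring R] [Algebra K R] [Ring A]
    [Algebra K A] [Ring T] [Algebra K T] {φ : R →ₐ[K] A} (hφ : Function.Surjective φ)
    (θ : R →ₐ[K] T) (h : ∀ y, φ y = 0 → θ y = 0) :
    ∃ θ' : A →ₐ[K] T, ∀ y, θ' (φ y) = θ y := by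
  have key : ∀ y z, φ y = φ z → θ y = θ z := fun y z hyz =>
    sub_eq_zero.1 <| by rw [← map_sub]; exact h _ (by rw [map_sub, hyz, sub_self])
  have hinv := Function.surjInv_eq hφ
  refine ⟨AlgHom.ofLinearMap
    { toFun := fun a => θ (Function.surjInv hφ a)
      map_add' := fun a b => ?_
      map_smul' := fun r a => ?_ } ?_ fun a b => ?_, fun y => key _ _ (hinv _)⟩
  · rw [← map_add]
    exact key _ _ (by rw [map_add, hinv, hinv, hinv])
  · rw [RingHom.id_apply, ← map_smul]
    exact key _ _ (by rw [map_smul, hinv, hinv])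
  · rw [← map_one θ]
    exact key _ _ (by rw [map_one, hinv])
  · simp only [LinearMap.coe_mk, AddHom.coe_mk]
    rw [← map_mul]
    exact key _ _ (by rw [map_mul, hinv, hinv, hinv])

variable {K Q} {A : Type} [Ring A] [Algebra K A] (φ : PathAlgebra K Q →ₐ[K] A) (i : Q.V)

/-- The quotient of `A` by the two-sided ideal generated by the idempotents of the vertices
different from `i`. -/
abbrev LocalAlgebra : Type :=
  RingQuot fun x y : A => ∃ j, j ≠ i ∧ x = φ (vertexElem K Q j) ∧ y = 0

/-- The projection of the path algebra onto the local algebra at a vertex. -/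
def toLocal : PathAlgebra K Q →ₐ[K] LocalAlgebra φ i := (RingQuot.mkAlgHom K _).comp φ

theorem toLocal_vertexElem_of_ne {j : Q.V} (h : j ≠ i) :
    toLocal φ i (vertexElem K Q j) = 0 := by
  rw [toLocal, AlgHom.comp_apply, ← map_zero (RingQuot.mkAlgHom K _)]
  exact RingQuot.mkAlgHom_rel K ⟨j, h, rfl, rfl⟩

theorem sum_vertexElem : ∑ j, vertexElem K Q j = 1 := by
  have := RingQuot.mkAlgHom_rel K (PathRel.sum_one (K := K) (Q := Q))
  simpa [vertexElem] using this

theorem vertexElem_tgt_mul_arrowElem (a : Q.A) :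
    vertexElem K Q (Q.tgt a) * arrowElem K Q a = arrowElem K Q a := by
  have := RingQuot.mkAlgHom_rel K (PathRel.tgt_mul (K := K) a)
  rwa [map_mul] at this

theorem arrowElem_mul_vertexElem_src (a : Q.A) :
    arrowElem K Q a * vertexElem K Q (Q.src a) = arrowElem K Q a := by
  have := RingQuot.mkAlgHom_rel K (PathRel.mul_src (K := K) a)
  rwa [map_mul] at this

theorem toLocal_vertexElem_self : toLocal φ i (vertexElem K Q i) = 1 := by
  have := congrArg (toLocal φ i) (sum_vertexElem (K := K) (Q := Q))
  rwa [map_sum, map_one, Finset.sum_eq_single i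
    (fun j _ hj => toLocal_vertexElem_of_ne φ i hj) (by simp)] at this

theorem toLocal_arrowElem_of_not_loop {a : Q.A} (h : ¬(Q.src a = i ∧ Q.tgt a = i)) :
    toLocal φ i (arrowElem K Q a) = 0 := by
  rcases not_and_or.1 h with h | h
  · rw [← arrowElem_mul_vertexElem_src, map_mul, toLocal_vertexElem_of_ne φ i h, mul_zero]
  · rw [← vertexElem_tgt_mul_arrowElem, map_mul, toLocal_vertexElem_of_ne φ i h, zero_mul]

variable {φ}

theorem toLocal_surjective (hφ : Function.Surjective φ) :
    Function.Surjective (toLocal φ i) :=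
  (RingQuot.mkAlgHom_surjective K _).comp hφ

theorem adjoin_range_toLocal_arrowElem (hφ : Function.Surjective φ) :
    Algebra.adjoin K (Set.range fun a => toLocal φ i (arrowElem K Q a)) = ⊤ := by
  rw [eq_top_iff]
  rintro x -
  obtain ⟨y, rfl⟩ := toLocal_surjective i hφ x
  obtain ⟨z, rfl⟩ := RingQuot.mkAlgHom_surjective K _ y
  induction z using FreeAlgebra.induction with
  | grade0 r => simp
  | grade1 v =>
    rcases v with j | a
    · change toLocal φ i (vertexElem K Q j) ∈ _
      by_cases h : j = i
      · rw [h, toLocal_vertexElem_self]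
        exact one_mem _
      · rw [toLocal_vertexElem_of_ne φ i h]
        exact zero_mem _
    · exact Algebra.subset_adjoin ⟨a, rfl⟩
  | mul x y hx hy => simpa using mul_mem hx hy
  | add x y hx hy => simpa using add_mem hx hy

theorem isNilpotent_toLocal_arrowElem {m : ℕ} (hm : 2 ≤ m)
    (hpath : ∀ p : QPath Q, m ≤ p.length → φ (pathElem K Q p) = 0) (a : Q.A) :
    IsNilpotent (toLocal φ i (arrowElem K Q a)) := by
  by_cases h : Q.src a = i ∧ Q.tgt a = i
  · let p : QPath Q :=
      { arrows := List.replicate m a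
        ne := by simp; omega
        chain := List.isChain_replicate_of_rel m (h.1.trans h.2.symm) }
    have hp := hpath p (by simp [p, QPath.length])
    refine ⟨m, ?_⟩
    rw [toLocal, AlgHom.comp_apply, ← map_pow, ← map_pow]
    have : pathElem K Q p = arrowElem K Q a ^ m := by simp [pathElem, p]
    rw [← this, hp, map_zero]
  · rw [toLocal_arrowElem_of_not_loop φ i h]
    exact IsNilpotent.zero

/-- An assignment of elements to the loops at `i` extends to the path algebra. -/
theorem exists_pathAlgebra_hom {T : Type} [Ring T] [Algebra K T] (x : Q.A → T)
    (hx : ∀ a, ¬(Q.src a = i ∧ Q.tgt a = i) → x a = 0) :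
    ∃ θ : PathAlgebra K Q →ₐ[K] T,
      (∀ a, θ (arrowElem K Q a) = x a) ∧ ∀ j ≠ i, θ (vertexElem K Q j) = 0 := by
  let g : FreeAlgebra K (Q.V ⊕ Q.A) →ₐ[K] T :=
    FreeAlgebra.lift K (Sum.elim (fun j => if j = i then 1 else 0) x)
  have hg : ∀ ⦃u v⦄, PathRel K Q u v → g u = g v := by
    rintro _ _ (j | ⟨j, k, h⟩ | _ | a | a)
    · by_cases hj : j = i <;> simp [g, hj]
    · by_cases hj : j = i
      · have : k ≠ i := fun hk => h (hj.trans hk.symm)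
        simp [g, this]
      · simp [g, hj]
    · simp [g]
    · by_cases hj : Q.tgt a = i
      · simp [g, hj]
      · simp [g, hx a fun h => hj h.2]
    · by_cases hj : Q.src a = i
      · simp [g, hj]
      · simp [g, hx a fun h => hj h.1]
  refine ⟨RingQuot.liftAlgHom K ⟨g, hg⟩, fun a => ?_, fun j hj => ?_⟩
  · simp [arrowElem, g]
  · simp [vertexElem, g, hj]

theorem map_relElem {T : Type} [Ring T] [Algebra K T] (θ : PathAlgebra K Q →ₐ[K] T)
    (c : QPath Q →₀ K) :
    θ (relElem K Q c)
      = c.sum fun p l => l • (p.arrows.map fun a => θ (arrowElem K Q a)).prod := by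
  simp [relElem, pathElem, Finsupp.sum, map_list_prod, Function.comp_def]

/-- The universal property of the local algebra at a vertex. -/
theorem exists_localAlgebra_hom (hadm : IsAdmissiblePresentation K Q φ)
    {T : Type} [Ring T] [Algebra K T] (x : Q.A → T)
    (hx : ∀ a, ¬(Q.src a = i ∧ Q.tgt a = i) → x a = 0)
    (hrel : ∀ (c : QPath Q →₀ K) (j k : Q.V), IsRelationData K Q c j k →
      φ (relElem K Q c) = 0 → (c.sum fun p l => l • (p.arrows.map x).prod) = 0) :
    ∃ τ : LocalAlgebra φ i →ₐ[K] T, ∀ a, τ (toLocal φ i (arrowElem K Q a)) = x a := by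
  obtain ⟨θ, hθa, hθv⟩ := exists_pathAlgebra_hom (K := K) i x hx
  obtain ⟨hsurj, ⟨S, hS, hker⟩, -⟩ := hadm
  have hSφ : ∀ s ∈ S, φ s = 0 := by
    intro s hs
    have : s ∈ twoSidedSpan (PathAlgebra K Q) S :=
      AddSubgroup.subset_closure ⟨1, 1, s, hs, by simp⟩
    rwa [hker] at this
  have hle : ∀ y, φ y = 0 → θ y = 0 := by
    intro y hy
    have hy' : y ∈ twoSidedSpan (PathAlgebra K Q) S := by
      rw [hker]; exact hy
    have hsub : AddSubgroup.closure
        {x | ∃ a b : PathAlgebra K Q, ∃ s ∈ S, x = a * s * b} ≤ θ.toRingHom.toAddMonoidHom.ker := by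
      rw [AddSubgroup.closure_le]
      rintro _ ⟨u, v, s, hs, rfl⟩
      have : θ s = 0 := by
        obtain ⟨c, j, k, hc, rfl⟩ := hS s hs
        rw [map_relElem]
        simpa only [hθa] using hrel c j k hc (hSφ _ hs)
      change θ (u * s * v) = 0
      rw [map_mul, map_mul, this, mul_zero, zero_mul]
    exact hsub hy'
  obtain ⟨θ', hθ'⟩ := exists_algHom_apply_of_surjective hsurj θ hle
  refine ⟨RingQuot.liftAlgHom K ⟨θ', ?_⟩, fun a => ?_⟩
  · rintro _ _ ⟨j, hj, rfl, rfl⟩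
    rw [hθ', hθv j hj, map_zero]
  · rw [toLocal, AlgHom.comp_apply, RingQuot.liftAlgHom_mkAlgHom_apply, hθ', hθa]

/-- Two different loops at `i` are linearly independent modulo the square of the radical of
the local algebra. -/
theorem exists_localAlgebra_hom_trivSqZeroExt (hadm : IsAdmissiblePresentation K Q φ)
    {a b : Q.A} (hab : a ≠ b) (ha : Q.src a = i ∧ Q.tgt a = i)
    (hb : Q.src b = i ∧ Q.tgt b = i) :
    ∃ χ : LocalAlgebra φ i →ₐ[K] TrivSqZeroExt K (K × K),
      χ (toLocal φ i (arrowElem K Q a)) = TrivSqZeroExt.inr (1, 0) ∧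
      χ (toLocal φ i (arrowElem K Q b)) = TrivSqZeroExt.inr (0, 1) := by
  let x : Q.A → K × K := fun c => if c = a then (1, 0) else if c = b then (0, 1) else 0
  obtain ⟨χ, hχ⟩ := exists_localAlgebra_hom i hadm
    (fun c => (TrivSqZeroExt.inr (x c) : TrivSqZeroExt K (K × K)))
    (fun c hc => by
      have h1 : c ≠ a := by rintro rfl; exact hc ha
      have h2 : c ≠ b := by rintro rfl; exact hc hb
      simp [x, h1, h2])
    (fun c j k hc _ => by
      refine Finset.sum_eq_zero fun p hp => ?_
      have hlen := (hc p hp).1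
      obtain ⟨_ | ⟨u, _ | ⟨v, l⟩⟩, _, _⟩ := p
      · simp [QPath.length] at hlen
      · simp [QPath.length] at hlen
      · simp [← mul_assoc])
  exact ⟨χ, by simp [hχ, x], by simp [hχ, x, hab.symm]⟩

end LocalAlgebra

/-! ## Open conditions on representations -/

section OpenConditions

variable {K Q} {d : Q.V → ℕ}

/-- The evaluation of a representation at an arbitrary word in the arrows. -/
def wordProd {R ι : Type} [Semiring R] [Fintype ι] [DecidableEq ι] (M : Q.A → Matrix ι ι R)
    (w : List Q.A) : Matrix ι ι R := (w.map M).prod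

/-- The representation whose entries are the coordinate functions. -/
def genericRep (d : Q.V → ℕ) (a : Q.A) : Matrix (RepIx Q d) (RepIx Q d)
    (MvPolynomial (Q.A × RepIx Q d × RepIx Q d) K) :=
  Matrix.of fun u v => MvPolynomial.X (a, u, v)

/-- Evaluation of polynomials at a representation. -/
def evalRep (M : RepSpace K Q d) : MvPolynomial (Q.A × RepIx Q d × RepIx Q d) K →+* K :=
  MvPolynomial.eval fun x => M x.1 x.2.1 x.2.2

theorem map_wordProd_genericRep (M : RepSpace K Q d) (w : List Q.A) :
    (wordProd (genericRep d) w).map (evalRep M) = wordProd M w := by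
  have h : ∀ a, (evalRep M).mapMatrix (genericRep d a) = M a := fun a => by
    ext u v
    simp [genericRep, evalRep]
  rw [← RingHom.mapMatrix_apply, wordProd, map_list_prod, List.map_map]
  simp only [Function.comp_def, h, wordProd]

theorem isOpen_linearIndependent
    (N : Matrix (RepIx Q d) (RepIx Q d) (MvPolynomial (Q.A × RepIx Q d × RepIx Q d) K)) :
    @IsOpen _ (repTopology K Q d)
      {M | LinearIndependent K fun k l => evalRep M (N k l)} := by
  refine ⟨_, TopologicalSpace.isOpen_generateFrom_of_mem ⟨N.det, rfl⟩, ?_⟩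
  ext M
  have h := Matrix.linearIndependent_rows_iff_isUnit (A := N.map (evalRep M))
  rw [Matrix.isUnit_iff_isUnit_det, ← RingHom.mapMatrix_apply, ← RingHom.map_det,
    isUnit_iff_ne_zero] at h
  exact h.symm

theorem isOpen_linearIndependent_mulVec (v : RepIx Q d → K) (w : RepIx Q d → List Q.A) :
    @IsOpen _ (repTopology K Q d)
      {M | LinearIndependent K fun k => (wordProd M (w k)).mulVec v} := by
  convert! isOpen_linearIndependent
    (Matrix.of fun k => (wordProd (genericRep d) (w k)).mulVec (MvPolynomial.C ∘ v)) using 4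
    with M
  ext k l
  rw [Matrix.of_apply, RingHom.map_mulVec, map_wordProd_genericRep]
  congr 1
  ext
  simp [evalRep]

theorem isOpen_linearIndependent_vecMul (v : RepIx Q d → K) (w : RepIx Q d → List Q.A) :
    @IsOpen _ (repTopology K Q d)
      {M | LinearIndependent K fun k => Matrix.vecMul v (wordProd M (w k))} := by
  convert! isOpen_linearIndependent
    (Matrix.of fun k => Matrix.vecMul (MvPolynomial.C ∘ v) (wordProd (genericRep d) (w k)))
    using 4 with M
  ext k l
  rw [Matrix.of_apply, RingHom.map_vecMul, map_wordProd_genericRep]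
  congr 1
  ext
  simp [evalRep]

end OpenConditions

/-! ## Bicyclic representations from geometric irreducibility -/

section GeomIrreducible

variable {K Q}

/-- The image of a generating set under a surjective linear map contains a basis consisting of
images of words. -/
theorem exists_linearIndependent_words {B W X ι : Type} [Ring B] [Algebra K B]
    [AddCommGroup W] [Module K W] [FiniteDimensional K W] [Fintype ι]
    (hι : Fintype.card ι = Module.finrank K W) {y : X → B}
    (hy : Algebra.adjoin K (Set.range y) = ⊤) (h : B →ₗ[K] W) (hh : Function.Surjective h) :
    ∃ w : ι → List X, LinearIndependent K fun k => h ((w k).map y).prod := by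
  obtain ⟨κ, a, -, hspan, hli⟩ := exists_linearIndependent' K
    fun w : List X => h (w.map y).prod
  have htop : Submodule.span K (Set.range fun w : List X => h (w.map y).prod) = ⊤ := by
    have h1 : Submodule.span K (Set.range fun w : List X => (w.map y).prod) = ⊤ := by
      rw [eq_top_iff, ← Algebra.top_toSubmodule, ← hy, Algebra.adjoin_eq_span]
      refine Submodule.span_mono fun x hx => ?_
      rw [← FreeMonoid.mrange_lift] at hx
      obtain ⟨w, rfl⟩ := hx
      exact ⟨w.toList, (FreeMonoid.lift_apply y w).symm⟩
    have h2 : (Set.range fun w : List X => h (w.map y).prod)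
        = h '' Set.range fun w : List X => (w.map y).prod := by
      rw [← Set.range_comp]; rfl
    rw [h2, Submodule.span_image, h1, Submodule.map_top, LinearMap.range_eq_top.2 hh]
  let b : Module.Basis κ K W := Module.Basis.mk hli (hspan.trans htop).ge
  have : Fintype κ := FiniteDimensional.fintypeBasisIndex b
  let e : ι ≃ κ := Fintype.equivOfCardEq (hι.trans (Module.finrank_eq_card_basis b))
  exact ⟨a ∘ e, hli.comp e e.injective⟩

theorem wordProd_algHom {B ι : Type} [Ring B] [Algebra K B] [Fintype ι]
    [DecidableEq ι] (ρ : B →ₐ[K] Matrix ι ι K) (y : Q.A → B) (w : List Q.A) :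
    wordProd (fun a => ρ (y a)) w = ρ (w.map y).prod := by
  simp [wordProd, map_list_prod, Function.comp_def]

variable {A : Type} [Ring A] [Algebra K A] {φ : PathAlgebra K Q →ₐ[K] A} {i : Q.V}

/-- The dimension vector concentrated at `i` with value `n`. -/
def singleDim (i : Q.V) (n : ℕ) : Q.V → ℕ := fun j => if j = i then n else 0

theorem card_repIx_singleDim (n : ℕ) : Fintype.card (RepIx Q (singleDim i n)) = n := by
  rw [Fintype.card_sigma]
  simp_rw [Fintype.card_fin]
  simp [singleDim]

theorem RepIx.fst_eq {n : ℕ} (u : RepIx Q (singleDim i n)) : u.1 = i := by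
  by_contra h
  have := u.2.pos
  simp [singleDim, h] at this

theorem mem_repSet_of_algHom {n : ℕ}
    (ρ : LocalAlgebra φ i →ₐ[K] Matrix (RepIx Q (singleDim i n)) (RepIx Q (singleDim i n)) K) :
    (fun a => ρ (toLocal φ i (arrowElem K Q a))) ∈ RepSet K Q φ (singleDim i n) := by
  refine ⟨fun a u v h => ?_, fun c j k _ hc => ?_⟩
  · have : Q.src a = i ∧ Q.tgt a = i := by
      by_contra hne
      simp [toLocal_arrowElem_of_not_loop φ i hne] at h
    exact ⟨u.fst_eq.trans this.2.symm, v.fst_eq.trans this.1.symm⟩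
  · have h := map_relElem (ρ.comp (toLocal φ i)) c
    rw [AlgHom.comp_apply, toLocal, AlgHom.comp_apply, hc, map_zero, map_zero] at h
    exact h.symm

theorem exists_algHom_of_mem_repSet (hadm : IsAdmissiblePresentation K Q φ) {n : ℕ}
    {M : RepSpace K Q (singleDim i n)} (hM : M ∈ RepSet K Q φ (singleDim i n)) :
    ∃ τ : LocalAlgebra φ i →ₐ[K] Matrix (RepIx Q (singleDim i n)) (RepIx Q (singleDim i n)) K,
      ∀ a, τ (toLocal φ i (arrowElem K Q a)) = M a := by
  refine exists_localAlgebra_hom i hadm M (fun a ha => ?_) hM.2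
  ext u v
  by_contra hne
  obtain ⟨h1, h2⟩ := hM.1 a u v hne
  exact ha ⟨h2.symm.trans v.fst_eq, h1.symm.trans u.fst_eq⟩

/-- A cyclic representation of the local algebra gives a point of the representation variety
satisfying an open condition that forces cyclicity. -/
theorem IsCyclicVector.exists_mem_repSet (hφ : Function.Surjective φ) {V : Type}
    [AddCommGroup V] [Module K V] [FiniteDimensional K V] {n : ℕ}
    (hn : Module.finrank K V = n) {ρ : LocalAlgebra φ i →ₐ[K] Module.End K V} {v : V}
    (hv : IsCyclicVector ρ v) :
    ∃ M ∈ RepSet K Q φ (singleDim i n), ∃ (x : RepIx Q (singleDim i n) → K)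
      (w : RepIx Q (singleDim i n) → List Q.A),
      LinearIndependent K fun k => (wordProd M (w k)).mulVec x := by
  have hcard : Fintype.card (RepIx Q (singleDim i n)) = Module.finrank K V :=
    (card_repIx_singleDim n).trans hn.symm
  let b : Module.Basis (RepIx Q (singleDim i n)) K V := (Module.finBasis K V).reindex
    (Fintype.equivOfCardEq (by rw [hcard, Fintype.card_fin]))
  let ρ' := (LinearMap.toMatrixAlgEquiv b).toAlgHom.comp ρ
  obtain ⟨w, hw⟩ := exists_linearIndependent_words hcard
    (adjoin_range_toLocal_arrowElem i hφ) ((LinearMap.applyₗ v) ∘ₗ ρ.toLinearMap) hv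
  refine ⟨_, mem_repSet_of_algHom ρ', b.equivFun v, w, ?_⟩
  have h := hw.map' b.equivFun.toLinearMap b.equivFun.ker
  convert! h using 2 with k
  rw [wordProd_algHom]
  exact LinearMap.toMatrix_mulVec_repr b b _ v

/-- A cocyclic representation of the local algebra gives a point of the representation variety
satisfying an open condition that forces cocyclicity. -/
theorem IsCocyclicForm.exists_mem_repSet (hφ : Function.Surjective φ) {V : Type}
    [AddCommGroup V] [Module K V] [FiniteDimensional K V] {n : ℕ}
    (hn : Module.finrank K V = n) {ρ : LocalAlgebra φ i →ₐ[K] Module.End K V}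
    {f : Module.Dual K V} (hf : IsCocyclicForm ρ f) :
    ∃ M ∈ RepSet K Q φ (singleDim i n), ∃ (x : RepIx Q (singleDim i n) → K)
      (w : RepIx Q (singleDim i n) → List Q.A),
      LinearIndependent K fun k => Matrix.vecMul x (wordProd M (w k)) := by
  have hcard : Fintype.card (RepIx Q (singleDim i n)) = Module.finrank K V :=
    (card_repIx_singleDim n).trans hn.symm
  let b : Module.Basis (RepIx Q (singleDim i n)) K V := (Module.finBasis K V).reindex
    (Fintype.equivOfCardEq (by rw [hcard, Fintype.card_fin]))
  let ρ' := (LinearMap.toMatrixAlgEquiv b).toAlgHom.comp ρ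
  let h : LocalAlgebra φ i →ₗ[K] Module.Dual K V := (LinearMap.compRight K f) ∘ₗ ρ.toLinearMap
  have hh : Function.Surjective h := by
    have hbot : (LinearMap.range h).dualCoannihilator = ⊥ := by
      rw [eq_bot_iff]
      intro x hx
      rw [Submodule.mem_dualCoannihilator] at hx
      exact hf x fun c => hx _ ⟨c, rfl⟩
    rw [← LinearMap.range_eq_top,
      ← Subspace.dualCoannihilator_dualAnnihilator_eq (W := LinearMap.range h), hbot,
      Submodule.dualAnnihilator_bot]
  obtain ⟨w, hw⟩ := exists_linearIndependent_words
    (hcard.trans Subspace.dual_finrank_eq.symm) (adjoin_range_toLocal_arrowElem i hφ) h hh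
  refine ⟨_, mem_repSet_of_algHom ρ', fun k => f (b k), w, ?_⟩
  have hli := hw.map' (b.constr K).symm.toLinearMap (b.constr K).symm.ker
  convert! hli using 2 with k
  rw [wordProd_algHom]
  ext l
  change _ = f (ρ _ (b l))
  rw [← b.sum_repr (ρ _ (b l)), map_sum, Matrix.vecMul, dotProduct]
  refine Finset.sum_congr rfl fun m _ => ?_
  rw [map_smul, smul_eq_mul, mul_comm]
  congr 1
  exact LinearMap.toMatrixAlgEquiv_apply b _ m l

theorem IsGeomIrreducible.hasBicyclicReps (hadm : IsAdmissiblePresentation K Q φ)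
    (hirr : IsGeomIrreducible K Q φ) (i : Q.V) : HasBicyclicReps K (LocalAlgebra φ i) := by
  intro V W _ _ _ _ _ _ ρ σ v f hVW hv hf
  set n := Module.finrank K V with hn
  obtain ⟨M₁, hM₁, x, w, hw⟩ := hv.exists_mem_repSet hadm.1 hn.symm
  obtain ⟨M₂, hM₂, z, t, ht⟩ := hf.exists_mem_repSet hadm.1 hVW.symm
  obtain ⟨M, hM, hMw, hMt⟩ := (hirr (singleDim i n)).2 _ _
    (isOpen_linearIndependent_mulVec x w) (isOpen_linearIndependent_vecMul z t)
    ⟨M₁, hM₁, hw⟩ ⟨M₂, hM₂, ht⟩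
  obtain ⟨τ, hτ⟩ := exists_algHom_of_mem_repSet hadm hM
  obtain rfl : (fun a => τ (toLocal φ i (arrowElem K Q a))) = M := funext hτ
  simp only [Set.mem_ofPred_eq, wordProd_algHom] at hMw hMt
  refine ⟨_, inferInstance, (Matrix.toLinAlgEquiv').toAlgHom.comp τ, x,
    dotProductBilin K K z, card_repIx_singleDim n, ?_, ?_⟩
  · have hspan := hMw.span_eq_top_of_card_eq_finrank' (by simp)
    let h : LocalAlgebra φ i →ₗ[K] (RepIx Q (singleDim i n) → K) :=
      (LinearMap.applyₗ x) ∘ₗ ((Matrix.toLinAlgEquiv').toAlgHom.comp τ).toLinearMap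
    have : LinearMap.range h = ⊤ := by
      rw [eq_top_iff, ← hspan, Submodule.span_le]
      rintro _ ⟨k, rfl⟩
      exact ⟨_, rfl⟩
    exact LinearMap.range_eq_top.1 this
  · intro y hy
    have hspan := hMt.span_eq_top_of_card_eq_finrank' (by simp)
    refine dotProduct_eq_zero y fun u => ?_
    have hu : u ∈ Submodule.span K _ := hspan ▸ Submodule.mem_top
    induction hu using Submodule.span_induction with
    | mem u hu =>
      obtain ⟨k, rfl⟩ := hu
      rw [dotProduct_comm, ← Matrix.dotProduct_mulVec]
      exact hy _
    | zero => simp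
    | add u u' _ _ h h' => rw [dotProduct_add, h, h', add_zero]
    | smul r u _ h => rw [dotProduct_smul, h, smul_zero]

end GeomIrreducible

/-- Let `A = KQ/I` be a finite-dimensional algebra over an algebraically
closed field `K`, where `Q` is a finite quiver and `I` is an admissible ideal of `KQ`.
If `A` is geometrically irreducible, then for each vertex `i` of `Q` there is at most one
loop `ε` with `s(ε) = i`. -/
theorem at_most_one_loop_of_geomIrreducible [IsAlgClosed K]
    (A : Type) [Ring A] [Algebra K A] [Module.Finite K A]
    (φ : PathAlgebra K Q →ₐ[K] A) (hadm : IsAdmissiblePresentation K Q φ)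
    (hirr : IsGeomIrreducible K Q φ) :
    ∀ a b : Q.A, Q.src a = Q.tgt a → Q.src b = Q.tgt b → Q.src a = Q.src b → a = b := by
  intro a b ha hb hab
  by_contra hne
  have hφ := hadm.1
  obtain ⟨m, hm, hpath⟩ := hadm.2.2
  obtain ⟨χ, hχa, hχb⟩ := exists_localAlgebra_hom_trivSqZeroExt (Q.src a) hadm hne
    ⟨rfl, ha.symm⟩ ⟨hab.symm, hb.symm.trans hab.symm⟩
  have : Module.Finite K (LocalAlgebra φ (Q.src a)) :=
    Module.Finite.of_surjective (RingQuot.mkAlgHom K _).toLinearMap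
      (RingQuot.mkAlgHom_surjective K _)
  refine (hirr.hasBicyclicReps hadm (Q.src a)).not_inr_basis
    (adjoin_range_toLocal_arrowElem (Q.src a) hφ) ?_ χ ⟨a, rfl⟩ ⟨b, rfl⟩ hχa hχb
  rintro _ ⟨c, rfl⟩
  exact isNilpotent_toLocal_arrowElem (Q.src a) hm hpath c
end
end
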